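/- Let n ≥ 2 and let F_n be the free group on n generators. Then for every positive cone P of a left-ordering of F_n and every finite subset S ⊆ P there exists a positive cone Q of a dense left-ordering of F_n with S ⊆ Q. (That is, LO(F_n) equals the closure of the set D(F_n) of dense orderings.) -/

import Mathlib

/-- `P` is the positive cone of a left-ordering of `G`: closed under multiplication,
and `G` is the disjoint union of `P`, `P⁻¹` and `{1}`. -/
def IsLeftCone {G : Type*} [Group G] (P : Set G) : Prop :=
  (∀ a ∈ P, ∀ b ∈ P, a * b ∈ P) ∧
  (∀ g : G, g ∈ P ∨ g⁻¹ ∈ P ∨ g = 1) ∧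
  (∀ g ∈ P, g⁻¹ ∉ P) ∧
  (1 : G) ∉ P

/-- `P` has a least element with respect to the left-order it defines. -/
def ConeHasLeast {G : Type*} [Group G] (P : Set G) : Prop :=
  ∃ p ∈ P, ∀ q ∈ P, q = p ∨ p⁻¹ * q ∈ P

/-- `P` is the positive cone of a dense left-ordering of `G`. -/
def IsDenseCone {G : Type*} [Group G] (P : Set G) : Prop :=
  IsLeftCone P ∧ ¬ ConeHasLeast P

/-- `P` is a Conradian positive cone. -/
def IsConradianCone {G : Type*} [Group G] (P : Set G) : Prop :=
  ∀ g ∈ P, ∀ h ∈ P, g⁻¹ * h * g ^ 2 ∈ P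

/-- The subgroup `C` is convex relative to the positive cone `P`. -/
def IsConvexSubgroup {G : Type*} [Group G] (P : Set G) (C : Subgroup G) : Prop :=
  ∀ g ∈ C, ∀ h ∈ C, ∀ f : G, g⁻¹ * f ∈ P → f⁻¹ * h ∈ P → f ∈ C

/-- `G` is bi-orderable: it admits a positive cone invariant under conjugation. -/
def IsBiOrderable (G : Type*) [Group G] : Prop :=
  ∃ P : Set G, IsLeftCone P ∧ ∀ g : G, ∀ p ∈ P, g * p * g⁻¹ ∈ P

theorem IsLeftCone.comap {G H : Type*} [Group G] [Group H] {P : Set G} (hP : IsLeftCone P)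
    (f : H →* G) (hf : Function.Injective f) : IsLeftCone (f ⁻¹' P) := by
  obtain ⟨hmul, htri, hdisj, hone⟩ := hP
  refine ⟨fun a ha b hb => ?_, fun g => ?_, fun g hg => ?_, ?_⟩
  · simpa using hmul _ ha _ hb
  · rcases htri (f g) with h | h | h
    · exact Or.inl h
    · exact Or.inr (Or.inl (by simpa using h))
    · exact Or.inr (Or.inr (hf (by simpa using h)))
  · simpa using hdisj _ hg
  · simpa using hone

theorem IsDenseCone.comap_mulEquiv {G H : Type*} [Group G] [Group H] {P : Set G}
    (hP : IsDenseCone P) (e : H ≃* G) : IsDenseCone (e ⁻¹' P) := by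
  refine ⟨hP.1.comap e.toMonoidHom e.injective, ?_⟩
  rintro ⟨p, hp, hleast⟩
  refine hP.2 ⟨e p, hp, fun q hq => ?_⟩
  rcases hleast (e.symm q) (by simpa using hq) with h | h
  · left
    simp [← h]
  · right
    simpa using h

/-- The lexicographic extension of a dense cone on a convex subgroup, given as the image of an
injective homomorphism, is dense. -/
theorem IsDenseCone.lex {N G : Type*} [Group N] [Group G] (i : N →* G)
    (hi : Function.Injective i) {A : Set G} (hmul : ∀ a ∈ A, ∀ b ∈ A, a * b ∈ A)
    (hl : ∀ n, ∀ a ∈ A, i n * a ∈ A) (hr : ∀ n, ∀ a ∈ A, a * i n ∈ A)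
    (htri : ∀ g, g ∈ A ∨ g⁻¹ ∈ A ∨ ∃ n, i n = g) (hdisj : ∀ g ∈ A, g⁻¹ ∉ A)
    (hi' : ∀ n, i n ∉ A) {R : Set N} (hR : IsDenseCone R) (hne : R.Nonempty) :
    IsDenseCone (A ∪ i '' R) := by
  obtain ⟨⟨Rmul, Rtri, Rdisj, Rone⟩, Rdense⟩ := hR
  refine ⟨⟨?_, fun g => ?_, ?_, ?_⟩, ?_⟩
  · rintro a (ha | ⟨r, hr', rfl⟩) b (hb | ⟨s, hs, rfl⟩)
    · exact Or.inl (hmul _ ha _ hb)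
    · exact Or.inl (hr _ _ ha)
    · exact Or.inl (hl _ _ hb)
    · exact Or.inr ⟨r * s, Rmul _ hr' _ hs, map_mul _ _ _⟩
  · rcases htri g with h | h | ⟨n, rfl⟩
    · exact Or.inl (Or.inl h)
    · exact Or.inr (Or.inl (Or.inl h))
    · rcases Rtri n with h | h | h
      · exact Or.inl (Or.inr ⟨n, h, rfl⟩)
      · exact Or.inr (Or.inl (Or.inr ⟨n⁻¹, h, map_inv _ _⟩))
      · exact Or.inr (Or.inr (by simp [h]))
  · rintro g (hg | ⟨r, hr', rfl⟩) (h | ⟨s, hs, h⟩)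
    · exact hdisj _ hg h
    · refine hi' s⁻¹ ?_
      rw [map_inv, h, inv_inv]
      exact hg
    · exact hi' r⁻¹ (by rwa [map_inv])
    · rw [← map_inv] at h
      exact Rdisj _ hr' (hi h ▸ hs)
  · rintro (h | ⟨s, hs, h⟩)
    · exact hi' 1 (by rwa [map_one])
    · rw [← map_one i] at h
      exact Rone (hi h ▸ hs)
  · rintro ⟨p, hp | ⟨r, hr', rfl⟩, hleast⟩
    · obtain ⟨r, hr'⟩ := hne
      rcases hleast (i r) (Or.inr ⟨r, hr', rfl⟩) with h | h | ⟨n, -, h⟩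
      · exact hi' r (h ▸ hp)
      · refine hdisj _ h ?_
        rw [mul_inv_rev, inv_inv, ← map_inv]
        exact hl _ _ hp
      · refine hi' (r * n⁻¹) ?_
        rw [map_mul, map_inv, h]
        simpa using hp
    · refine Rdense ⟨r, hr', fun q hq => ?_⟩
      rcases hleast (i q) (Or.inr ⟨q, hq, rfl⟩) with h | h | ⟨n, hn, h⟩
      · exact Or.inl (hi h)
      · rw [← map_inv, ← map_mul] at h
        exact absurd h (hi' _)
      · rw [← map_inv, ← map_mul] at h
        exact Or.inr (hi h ▸ hn)

/-- A separating sequence of homomorphisms to a left-ordered group with nontrivial finite partial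
kernels yields a dense ordering, comparing at the first homomorphism that does not vanish. -/
theorem exists_isDenseCone_of_separating {G L : Type*} [Group G] [Group L] {P : Set L}
    (hP : IsLeftCone P) (f : ℕ → G →* L) (hsep : ∀ g, g ≠ 1 → ∃ k, f k g ≠ 1)
    (hker : ∀ k, ∃ u, u ≠ 1 ∧ ∀ j ≤ k, f j u = 1) : ∃ Q : Set G, IsDenseCone Q := by
  obtain ⟨Pmul, Ptri, Pdisj, Pone⟩ := hP
  set Q : Set G := {g | ∃ k, f k g ∈ P ∧ ∀ j < k, f j g = 1}
  have Qtri : ∀ g, g ∈ Q ∨ g⁻¹ ∈ Q ∨ g = 1 := by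
    intro g
    by_cases hg : g = 1
    · exact Or.inr (Or.inr hg)
    · classical
      have hex := hsep g hg
      have hlt : ∀ j < Nat.find hex, f j g = 1 := fun j hj => not_not.1 (Nat.find_min hex hj)
      rcases Ptri (f (Nat.find hex) g) with h | h | h
      · exact Or.inl ⟨_, h, hlt⟩
      · exact Or.inr (Or.inl ⟨_, by simpa using h, fun j hj => by simp [hlt j hj]⟩)
      · exact absurd h (Nat.find_spec hex)
  have Qdisj : ∀ g ∈ Q, g⁻¹ ∉ Q := by
    rintro g ⟨k, hk, hk'⟩ ⟨l, hl, hl'⟩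
    rw [map_inv] at hl
    rcases lt_trichotomy k l with h | h | h
    · have := hl' k h
      rw [map_inv, inv_eq_one] at this
      exact Pone (this ▸ hk)
    · subst h
      exact Pdisj _ hk hl
    · rw [hk' l h, inv_one] at hl
      exact Pone hl
  refine ⟨Q, ⟨⟨?_, Qtri, Qdisj, ?_⟩, ?_⟩⟩
  · rintro a ⟨k, hk, hk'⟩ b ⟨l, hl, hl'⟩
    rcases lt_trichotomy k l with h | h | h
    · exact ⟨k, by simpa [hl' k h] using hk, fun j hj => by simp [hk' j hj, hl' j (hj.trans h)]⟩
    · subst h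
      exact ⟨k, by simpa using Pmul _ hk _ hl, fun j hj => by simp [hk' j hj, hl' j hj]⟩
    · exact ⟨l, by simpa [hk' l h] using hl, fun j hj => by simp [hl' j hj, hk' j (hj.trans h)]⟩
  · rintro ⟨k, hk, -⟩
    exact Pone (by simpa using hk)
  · rintro ⟨p, ⟨k, hk, hk'⟩, hleast⟩
    obtain ⟨u, hu, huQ, huk⟩ : ∃ u, u ≠ 1 ∧ u ∈ Q ∧ ∀ j ≤ k, f j u = 1 := by
      obtain ⟨u, hu, huk⟩ := hker k
      rcases Qtri u with h | h | h
      · exact ⟨u, hu, h, huk⟩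
      · exact ⟨u⁻¹, inv_ne_one.2 hu, h, fun j hj => by simp [huk j hj]⟩
      · exact absurd h hu
    rcases hleast u huQ with h | h
    · exact Pone (huk k le_rfl ▸ h ▸ hk)
    · refine Qdisj _ h ⟨k, ?_, fun j hj => ?_⟩
      · simpa [huk k le_rfl] using hk
      · simp [huk j hj.le, hk' j hj]

theorem exists_isDenseCone_freeGroup_of_unbounded {X : Type*} (ν : X → ℕ)
    (hν : ∀ k, ∃ x, k ≤ ν x) {P : Set (FreeGroup X)} (hP : IsLeftCone P) :
    ∃ Q : Set (FreeGroup X), IsDenseCone Q := by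
  let f : ℕ → FreeGroup X →* FreeGroup X := fun k =>
    FreeGroup.lift fun x => if ν x < k then FreeGroup.of x else 1
  have hfix : ∀ g, ∃ k, ∀ l ≥ k, f l g = g := by
    intro g
    induction g using FreeGroup.induction_on with
    | C1 => exact ⟨0, fun l _ => map_one _⟩
    | of x =>
      refine ⟨ν x + 1, fun l hl => ?_⟩
      simp [f, Nat.lt_of_succ_le hl]
    | inv_of x ih =>
      obtain ⟨k, hk⟩ := ih
      exact ⟨k, fun l hl => by rw [map_inv, hk l hl]⟩
    | mul a b iha ihb =>
      obtain ⟨k, hk⟩ := iha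
      obtain ⟨k', hk'⟩ := ihb
      exact ⟨max k k', fun l hl => by
        rw [map_mul, hk l (le_of_max_le_left hl), hk' l (le_of_max_le_right hl)]⟩
  refine exists_isDenseCone_of_separating hP f (fun g hg => ?_) fun k => ?_
  · obtain ⟨k, hk⟩ := hfix g
    exact ⟨k, by rwa [hk k le_rfl]⟩
  · obtain ⟨x, hx⟩ := hν k
    refine ⟨FreeGroup.of x, FreeGroup.of_ne_one x, fun j hj => ?_⟩
    simp [f, (hj.trans hx).not_gt]

/-- The free group on `Y` is the semidirect product of the free group on `ℤ × (Y \ {y₀})` by the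
shift action of `ℤ`, whose generator corresponds to `y₀`. -/
theorem exists_freeGroup_mulEquiv_semidirectProduct {Y : Type*} (y₀ : Y) :
    ∃ φ : Multiplicative ℤ →* MulAut (FreeGroup (ℤ × {y // y ≠ y₀})),
      Nonempty (FreeGroup Y ≃* FreeGroup (ℤ × {y // y ≠ y₀}) ⋊[φ] Multiplicative ℤ) := by
  classical
  let φ : Multiplicative ℤ →* MulAut (FreeGroup (ℤ × {y // y ≠ y₀})) :=
    { toFun := fun k => FreeGroup.freeGroupCongr
        (Equiv.prodCongr (Equiv.addLeft k.toAdd) (Equiv.refl _))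
      map_one' := by
        apply MulEquiv.toMonoidHom_injective
        ext x
        simp
      map_mul' := fun k l => by
        apply MulEquiv.toMonoidHom_injective
        ext x
        simp [add_assoc, Prod.map] }
  have hφ : ∀ k x, φ k (FreeGroup.of x) = FreeGroup.of (k.toAdd + x.1, x.2) := fun k x => by
    simp [φ, Prod.map]
  let Φ : FreeGroup Y →* FreeGroup (ℤ × {y // y ≠ y₀}) ⋊[φ] Multiplicative ℤ :=
    FreeGroup.lift fun y => if h : y = y₀ then SemidirectProduct.inr (Multiplicative.ofAdd 1)
      else SemidirectProduct.inl (FreeGroup.of (0, ⟨y, h⟩))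
  have hΦ₀ : Φ (FreeGroup.of y₀) = SemidirectProduct.inr (Multiplicative.ofAdd 1) := by simp [Φ]
  have hΦ : ∀ y : {y // y ≠ y₀},
      Φ (FreeGroup.of y) = SemidirectProduct.inl (FreeGroup.of (0, y)) := fun y => by
    simp [Φ, y.2]
  let Ψ : FreeGroup (ℤ × {y // y ≠ y₀}) ⋊[φ] Multiplicative ℤ →* FreeGroup Y :=
    SemidirectProduct.lift
      (FreeGroup.lift fun x =>
        FreeGroup.of y₀ ^ x.1 * FreeGroup.of x.2.1 * (FreeGroup.of y₀ ^ x.1)⁻¹)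
      (zpowersHom _ (FreeGroup.of y₀)) (fun k => by
        ext x
        simp [-map_zpow, hφ, zpow_add, mul_assoc])
  refine ⟨φ, ⟨MonoidHom.toMulEquiv Φ Ψ ?_ ?_⟩⟩
  · ext y
    by_cases h : y = y₀
    · subst h
      simp [hΦ₀, Ψ]
    · have := hΦ ⟨y, h⟩
      simp only at this
      simp [this, Ψ]
  · have hpow : ∀ k : ℤ,
        Φ (FreeGroup.of y₀) ^ k = SemidirectProduct.inr (Multiplicative.ofAdd k) := by
      intro k
      rw [hΦ₀, ← map_zpow, ← ofAdd_zsmul]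
      simp
    apply SemidirectProduct.hom_ext
    · ext x : 1
      simp only [MonoidHom.comp_apply, Ψ, SemidirectProduct.lift_inl, FreeGroup.lift_apply_of,
        map_mul, map_inv, map_zpow, hpow, hΦ, MonoidHom.id_apply]
      rw [← map_inv, ← SemidirectProduct.inl_aut, hφ]
      simp
    · ext : 1
      simp [Ψ, hΦ₀]

theorem exists_isDenseCone_freeGroup {Y : Type*} [Nontrivial Y] {P : Set (FreeGroup Y)}
    (hP : IsLeftCone P) : ∃ Q : Set (FreeGroup Y), IsDenseCone Q := by
  obtain ⟨y₀, y₁, hne⟩ := exists_pair_ne Y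
  obtain ⟨φ, ⟨e⟩⟩ := exists_freeGroup_mulEquiv_semidirectProduct y₀
  obtain ⟨R, hR⟩ := exists_isDenseCone_freeGroup_of_unbounded
    (fun x : ℤ × {y // y ≠ y₀} => x.1.natAbs) (fun k => ⟨(k, ⟨y₁, hne.symm⟩), by simp⟩)
    (hP.comap (e.symm.toMonoidHom.comp SemidirectProduct.inl)
      (e.symm.injective.comp SemidirectProduct.inl_injective))
  have hRne : R.Nonempty := by
    rcases hR.1.2.1 (FreeGroup.of (0, ⟨y₁, hne.symm⟩)) with h | h | h
    · exact ⟨_, h⟩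
    · exact ⟨_, h⟩
    · exact absurd h (FreeGroup.of_ne_one _)
  refine ⟨_, (IsDenseCone.lex SemidirectProduct.inl (SemidirectProduct.inl_injective (φ := φ))
    (A := {w | 1 < w.right}) ?_ ?_ ?_ ?_ ?_ ?_ hR hRne).comap_mulEquiv e⟩
  · intro a ha b hb
    simp only [Set.mem_ofPred_eq, SemidirectProduct.mul_right] at ha hb ⊢
    exact one_lt_mul' ha hb
  · intro n a ha
    simpa using ha
  · intro n a ha
    simpa using ha
  · intro g
    rcases lt_trichotomy 1 g.right with h | h | h
    · exact Or.inl h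
    · refine Or.inr (Or.inr ⟨g.left, ?_⟩)
      ext <;> simp [← h]
    · exact Or.inr (Or.inl (by simpa using h))
  · intro g hg
    simpa using le_of_lt hg
  · intro n
    simp

/-- A finite partial order isomorphism of a countable dense linear order without endpoints extends
to an automorphism. -/
theorem exists_orderIso_extending {α : Type*} [LinearOrder α] [Countable α] [DenselyOrdered α]
    [NoMinOrder α] [NoMaxOrder α] [Nonempty α] (T : Finset (α × α))
    (hT : ∀ p ∈ T, ∀ q ∈ T, p.1 < q.1 ↔ p.2 < q.2) :
    ∃ φ : α ≃o α, ∀ p ∈ T, φ p.1 = p.2 := by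
  cases nonempty_encodable α
  let f₀ : Order.PartialIso α α := ⟨T, fun p hp q hq => by
    rcases lt_trichotomy p.1 q.1 with h | h | h
    · rw [cmp_eq_lt_iff _ _ |>.2 h, cmp_eq_lt_iff _ _ |>.2 ((hT p hp q hq).1 h)]
    · have h' : p.2 = q.2 := le_antisymm
        (not_lt.1 fun hlt => ((hT q hq p hp).2 hlt).ne' h)
        (not_lt.1 fun hlt => ((hT p hp q hq).2 hlt).ne h)
      rw [cmp_eq_eq_iff _ _ |>.2 h, cmp_eq_eq_iff _ _ |>.2 h']
    · rw [cmp_eq_gt_iff _ _ |>.2 h, cmp_eq_gt_iff _ _ |>.2 ((hT q hq p hp).1 h)]⟩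
  let D : α ⊕ α → Order.Cofinal (Order.PartialIso α α) := fun p =>
    Sum.recOn p (Order.PartialIso.definedAtLeft α) (Order.PartialIso.definedAtRight α)
  let I : Order.Ideal (Order.PartialIso α α) := Order.idealOfCofinals f₀ D
  let F a := Order.PartialIso.funOfIdeal a I (Order.cofinal_meets_idealOfCofinals _ D (Sum.inl a))
  let G b := Order.PartialIso.invOfIdeal b I (Order.cofinal_meets_idealOfCofinals _ D (Sum.inr b))
  refine ⟨OrderIso.ofCmpEqCmp (fun a => (F a).val) (fun b => (G b).val) fun a b => ?_,
    fun p hp => ?_⟩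
  · rcases (F a).prop with ⟨f, hf, ha⟩
    rcases (G b).prop with ⟨g, hg, hb⟩
    rcases I.directed _ hf _ hg with ⟨m, _, fm, gm⟩
    exact m.prop (a, _) (fm ha) (_, b) (gm hb)
  · change (F p.1).val = p.2
    rcases (F p.1).prop with ⟨f, hf, ha⟩
    rcases I.directed _ hf _ (Order.mem_idealOfCofinals f₀ D) with ⟨m, _, fm, gm⟩
    have := m.prop (p.1, _) (fm ha) p (gm hp)
    rw [cmp_self_eq_eq] at this
    exact cmp_eq_eq_iff _ _ |>.1 this.symm

theorem IsLeftCone.exists_rat_embedding {G : Type*} [Group G] [Countable G] {P : Set G}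
    (hP : IsLeftCone P) : ∃ t : G → ℚ, ∀ g h, t g < t h ↔ g⁻¹ * h ∈ P := by
  classical
  obtain ⟨hmul, htri, hdisj, hone⟩ := hP
  let lin : LinearOrder G :=
    { lt := fun g h => g⁻¹ * h ∈ P
      le := fun g h => g⁻¹ * h ∈ P ∨ g = h
      le_refl := fun g => Or.inr rfl
      le_trans := by
        rintro a b c (h | rfl) (h' | rfl)
        · exact Or.inl (by simpa [mul_assoc] using hmul _ h _ h')
        · exact Or.inl h
        · exact Or.inl h'
        · exact Or.inr rfl
      le_antisymm := by
        rintro a b (h | h) (h' | h')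
        · exact absurd h' (by simpa using hdisj _ h)
        · exact h'.symm
        · exact h
        · exact h
      lt_iff_le_not_ge := by
        intro a b
        constructor
        · intro h
          refine ⟨Or.inl h, ?_⟩
          rintro (h' | rfl)
          · exact hdisj _ h (by simpa using h')
          · exact hone (by simpa using h)
        · rintro ⟨h | rfl, h'⟩
          · exact h
          · exact absurd (Or.inr rfl) h'
      le_total := by
        intro a b
        rcases htri (a⁻¹ * b) with h | h | h
        · exact Or.inl (Or.inl h)
        · exact Or.inr (Or.inl (by simpa using h))
        · exact Or.inl (Or.inr (inv_mul_eq_one.1 h))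
      toDecidableLE := Classical.decRel _ }
  obtain ⟨t⟩ := Order.embedding_from_countable_to_dense G ℚ
  exact ⟨t, fun g h => t.lt_iff_lt⟩

theorem exists_orderIso_extending_mul_left {G : Type*} [Group G] {P : Set G} {t : G → ℚ}
    (ht : ∀ g h, t g < t h ↔ g⁻¹ * h ∈ P) (B : Finset G) (c : G) (E : Finset (ℚ × ℚ))
    (hE : ∀ p ∈ E, ∀ q ∈ E, p.1 < q.1 ↔ p.2 < q.2)
    (hBE : ∀ g ∈ B, c * g ∈ B → ∀ e ∈ E, t g < e.1 ∧ t (c * g) < e.2) :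
    ∃ φ : ℚ ≃o ℚ, (∀ g ∈ B, c * g ∈ B → φ (t g) = t (c * g)) ∧ ∀ e ∈ E, φ e.1 = e.2 := by
  classical
  obtain ⟨φ, hφ⟩ := exists_orderIso_extending
    (((B.filter fun g => c * g ∈ B).image fun g => (t g, t (c * g))) ∪ E) (by
      intro p hp q hq
      simp only [Finset.mem_union, Finset.mem_image, Finset.mem_filter] at hp hq
      rcases hp with ⟨g, ⟨hg, hg'⟩, rfl⟩ | hp <;> rcases hq with ⟨h, ⟨hh, hh'⟩, rfl⟩ | hq
      · simp [ht, mul_assoc]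
      · exact iff_of_true (hBE g hg hg' q hq).1 (hBE g hg hg' q hq).2
      · exact iff_of_false (hBE h hh hh' p hp).1.not_gt (hBE h hh hh' p hp).2.not_gt
      · exact hE p hp q hq)
  refine ⟨φ, fun g hg hg' => hφ (t g, t (c * g)) ?_, fun e he => hφ e ?_⟩
  · exact Finset.mem_union_left _
      (Finset.mem_image_of_mem _ (Finset.mem_filter.2 ⟨hg, hg'⟩))
  · exact Finset.mem_union_right _ he

theorem FreeGroup.apply_mk_of_suffixes {X : Type*} (ρ : FreeGroup X →* (ℚ ≃o ℚ))
    (t : FreeGroup X → ℚ) (B : Set (FreeGroup X))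
    (hρ : ∀ x, ∀ g ∈ B, FreeGroup.of x * g ∈ B → ρ (FreeGroup.of x) (t g) = t (FreeGroup.of x * g))
    (L : List (X × Bool)) (hL : ∀ L', L' <:+ L → FreeGroup.mk L' ∈ B) :
    ρ (FreeGroup.mk L) (t 1) = t (FreeGroup.mk L) := by
  induction L with
  | nil => simp [← FreeGroup.one_eq_mk]
  | cons a L ih =>
    have hB := hL _ (List.suffix_cons a L)
    have hB' := hL _ List.suffix_rfl
    have ih' := ih fun L' h => hL L' (h.trans (List.suffix_cons a L))
    obtain ⟨x, _ | _⟩ := a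
    · have hmk : FreeGroup.mk ((x, false) :: L) = (FreeGroup.of x)⁻¹ * FreeGroup.mk L := by
        simp [FreeGroup.of, FreeGroup.inv_mk, FreeGroup.invRev]
      rw [hmk] at hB' ⊢
      rw [_root_.map_mul, RelIso.mul_apply, ih']
      have := hρ x _ hB' (by simpa using hB)
      rw [mul_inv_cancel_left] at this
      rw [← this, ← RelIso.mul_apply, ← _root_.map_mul, inv_mul_cancel, _root_.map_one]
      rfl
    · have hmk : FreeGroup.mk ((x, true) :: L) = FreeGroup.of x * FreeGroup.mk L := by
        simp [FreeGroup.of]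
      rw [hmk] at hB' ⊢
      rw [_root_.map_mul, RelIso.mul_apply, ih', hρ x _ hB hB']

theorem FreeGroup.exists_finset_suffix_closed {X : Type*} (S : Finset (FreeGroup X)) :
    ∃ B : Finset (FreeGroup X), 1 ∈ B ∧ S ⊆ B ∧
      ∀ g ∈ B, ∃ L, FreeGroup.mk L = g ∧ ∀ L', L' <:+ L → FreeGroup.mk L' ∈ B := by
  classical
  have key : ∀ g, g ∈ insert 1 (S.biUnion fun s => (s.toWord.tails.map FreeGroup.mk).toFinset) ↔
      g = 1 ∨ ∃ s ∈ S, ∃ L, L <:+ s.toWord ∧ FreeGroup.mk L = g := by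
    simp
  refine ⟨_, (key _).2 (Or.inl rfl), fun s hs => (key _).2 (Or.inr ⟨s, hs, _, List.suffix_rfl,
    FreeGroup.mk_toWord⟩), fun g hg => ?_⟩
  rcases (key _).1 hg with rfl | ⟨s, hs, L, hL, rfl⟩
  · refine ⟨[], rfl, fun L' h => (key _).2 (Or.inl ?_)⟩
    rw [List.suffix_nil.1 h]
    rfl
  · exact ⟨L, rfl, fun L' h => (key _).2 (Or.inr ⟨s, hs, L', h.trans hL, rfl⟩)⟩

theorem FreeGroup.not_commute_of_conj {X : Type*} {x y : X} (hxy : x ≠ y) {c : FreeGroup X}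
    (hc : c = FreeGroup.of x ∨ c = (FreeGroup.of x)⁻¹) :
    ¬ Commute (FreeGroup.of y) (c⁻¹ * FreeGroup.of y * c) := by
  classical
  intro h
  have h' := h.map (FreeGroup.lift fun z => if z = x then Equiv.swap (0 : Fin 3) 1
    else Equiv.swap 1 2)
  rcases hc with rfl | rfl <;>
  · simp only [_root_.map_mul, _root_.map_inv, FreeGroup.lift_apply_of, hxy.symm, if_true,
      if_false, inv_inv] at h'
    revert h'
    simp only [Commute, SemiconjBy]
    decide

/-- A finite part of a left-ordering of a nonabelian free group is realized by an action on `ℚ`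
in which the stabilizer of the base point is nonabelian. -/
theorem FreeGroup.exists_action_realizing {X : Type*} [Countable X] {x y : X} (hxy : x ≠ y)
    {P : Set (FreeGroup X)} (hP : IsLeftCone P) (S : Finset (FreeGroup X)) (hS : ↑S ⊆ P) :
    ∃ (ρ : FreeGroup X →* (ℚ ≃o ℚ)) (q : ℚ), (∀ s ∈ S, q < ρ s q) ∧
      ∃ u v, ρ u q = q ∧ ρ v q = q ∧ ¬ Commute u v := by
  classical
  obtain ⟨t, ht⟩ := hP.exists_rat_embedding
  obtain ⟨B, hB1, hSB, hB⟩ := FreeGroup.exists_finset_suffix_closed S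
  obtain ⟨m, hmB, hm⟩ := B.exists_max_image t ⟨1, hB1⟩
  obtain ⟨c, hc, hcm⟩ : ∃ c, (c = FreeGroup.of x ∨ c = (FreeGroup.of x)⁻¹) ∧ t m < t (c * m) := by
    rcases hP.2.1 (m⁻¹ * FreeGroup.of x * m) with h | h | h
    · exact ⟨_, Or.inl rfl, (ht _ _).2 (by simpa [mul_assoc] using h)⟩
    · exact ⟨_, Or.inr rfl, (ht _ _).2 (by simpa [mul_assoc] using h)⟩
    · rw [mul_assoc, inv_mul_eq_one, right_eq_mul] at h
      exact absurd h (FreeGroup.of_ne_one x)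
  have hcmB : c * m ∉ B := fun h => (hm _ h).not_gt hcm
  have hlt : ∀ g ∈ B, c * g ∈ B → t g < t m := by
    refine fun g hg hg' => lt_of_le_of_ne (hm g hg) fun he => hcmB ?_
    have hgm : g = m := by
      rcases hP.2.1 (g⁻¹ * m) with h | h | h
      · exact absurd he ((ht _ _).2 h).ne
      · exact absurd he ((ht _ _).2 (by simpa using h)).ne'
      · exact inv_mul_eq_one.1 h
    exact hgm ▸ hg'
  obtain ⟨φ, hφ, hφE⟩ := exists_orderIso_extending_mul_left ht B c
    {(t m, t m + 1), (t m + 1, t m + 2)} (by simp) (by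
      intro g hg hg' e he
      have h₁ := hlt g hg hg'
      have h₂ := hm _ hg'
      simp only [Finset.mem_insert, Finset.mem_singleton] at he
      rcases he with rfl | rfl <;> constructor <;> dsimp only <;> linarith)
  have hothers : ∀ z : X, ∃ ψ : ℚ ≃o ℚ,
      (∀ g ∈ B, FreeGroup.of z * g ∈ B → ψ (t g) = t (FreeGroup.of z * g)) ∧
      ∀ e ∈ ({(t m + 1, t m + 1), (t m + 2, t m + 2)} : Finset (ℚ × ℚ)), ψ e.1 = e.2 := by
    refine fun z => exists_orderIso_extending_mul_left ht B _ _ (by simp) ?_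
    intro g hg hg' e he
    have h₁ := hm _ hg
    have h₂ := hm _ hg'
    simp only [Finset.mem_insert, Finset.mem_singleton] at he
    rcases he with rfl | rfl <;> constructor <;> dsimp only <;> linarith
  choose ψ hψ hψE using hothers
  obtain ⟨ρ, hρc, hρx, hρ⟩ : ∃ ρ : FreeGroup X →* (ℚ ≃o ℚ), ρ c = φ ∧
      (∀ g ∈ B, FreeGroup.of x * g ∈ B → ρ (FreeGroup.of x) (t g) = t (FreeGroup.of x * g)) ∧
      ∀ z, z ≠ x → ρ (FreeGroup.of z) = ψ z := by
    rcases hc with rfl | rfl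
    · refine ⟨FreeGroup.lift (Function.update ψ x φ), by simp, ?_, fun z hz => by simp [hz]⟩
      simpa using hφ
    · refine ⟨FreeGroup.lift (Function.update ψ x φ⁻¹), by simp, fun g hg hg' => ?_,
        fun z hz => by simp [hz]⟩
      have := hφ _ hg' (by simpa using hg)
      rw [inv_mul_cancel_left] at this
      rw [← this]
      simp
  have hreal : ∀ g ∈ B, ρ g (t 1) = t g := by
    intro g hg
    obtain ⟨L, rfl, hL⟩ := hB g hg
    refine FreeGroup.apply_mk_of_suffixes ρ t B (fun z g hg hg' => ?_) L hL
    by_cases hz : z = x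
    · subst hz
      exact hρx g hg hg'
    · rw [hρ z hz]
      exact hψ z g hg hg'
  have hc₀ : ρ c (t m) = t m + 1 := by
    rw [hρc]
    exact hφE (_, _) (by simp)
  have hc₁ : ρ c (t m + 1) = t m + 2 := by
    rw [hρc]
    exact hφE (_, _) (by simp)
  have hy₁ : ρ (FreeGroup.of y) (t m + 1) = t m + 1 := by
    rw [hρ y hxy.symm]
    exact hψE y (_, _) (by simp)
  have hy₂ : ρ (FreeGroup.of y) (t m + 2) = t m + 2 := by
    rw [hρ y hxy.symm]
    exact hψE y (_, _) (by simp)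
  have hw : ρ (c * m) (t 1) = t m + 1 := by
    rw [_root_.map_mul, RelIso.mul_apply, hreal m hmB, hc₀]
  have hcy : ρ (c⁻¹ * FreeGroup.of y * c) (t m + 1) = t m + 1 := by
    rw [_root_.map_mul, _root_.map_mul, RelIso.mul_apply, RelIso.mul_apply, hc₁, hy₂, ← hc₁,
      ← RelIso.mul_apply, ← _root_.map_mul, inv_mul_cancel, _root_.map_one]
    rfl
  have hconj : ∀ g, ρ g (t m + 1) = t m + 1 → ρ ((c * m)⁻¹ * g * (c * m)) (t 1) = t 1 := by
    intro g hg
    rw [_root_.map_mul, _root_.map_mul, RelIso.mul_apply, RelIso.mul_apply, hw, hg, ← hw,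
      ← RelIso.mul_apply, ← _root_.map_mul, inv_mul_cancel, _root_.map_one]
    rfl
  refine ⟨ρ, t 1, fun s hs => ?_, _, _, hconj _ hy₁, hconj _ hcy, fun hcomm => ?_⟩
  · rw [hreal s (hSB hs), ht]
    simpa using hS hs
  · refine FreeGroup.not_commute_of_conj hxy hc ?_
    have := hcomm.map (MulAut.conj (c * m)).toMonoidHom
    simpa [mul_assoc] using this

theorem FreeGroup.exists_isDenseCone_subgroup {X : Type*} {P : Set (FreeGroup X)}
    (hP : IsLeftCone P) (H : Subgroup (FreeGroup X)) {u v : FreeGroup X} (hu : u ∈ H) (hv : v ∈ H)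
    (huv : ¬ Commute u v) : ∃ R : Set H, IsDenseCone R ∧ R.Nonempty := by
  let e := IsFreeGroup.toFreeGroup H
  have hnt : Nontrivial (IsFreeGroup.Generators H) := by
    by_contra hsub
    rw [not_nontrivial_iff_subsingleton] at hsub
    refine huv ?_
    have hcomm : ∀ a b : FreeGroup (IsFreeGroup.Generators H), a * b = b * a := by
      rcases isEmpty_or_nonempty (IsFreeGroup.Generators H) with hem | ⟨⟨z⟩⟩
      · exact fun a b => Subsingleton.elim _ _
      · have := uniqueOfSubsingleton z
        exact fun a b => IsCyclic.isMulCommutative.is_comm.comm a b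
    have h := e.injective (a₁ := ⟨u, hu⟩ * ⟨v, hv⟩) (a₂ := ⟨v, hv⟩ * ⟨u, hu⟩)
      (by rw [_root_.map_mul, _root_.map_mul, hcomm])
    exact congrArg Subtype.val h
  obtain ⟨R, hR⟩ := exists_isDenseCone_freeGroup (hP.comap (H.subtype.comp e.symm.toMonoidHom)
    (H.subtype_injective.comp e.symm.injective))
  have hR' := hR.comap_mulEquiv e
  refine ⟨_, hR', ?_⟩
  rcases hR'.1.2.1 ⟨u, hu⟩ with h | h | h
  · exact ⟨_, h⟩
  · exact ⟨_, h⟩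
  · refine absurd ?_ huv
    rw [show u = 1 from congrArg Subtype.val h]
    exact Commute.one_left v

/-- The cone of an action by order automorphisms, refined by a dense cone on a stabilizer. -/
theorem IsDenseCone.of_stabilizer {G α : Type*} [Group G] [LinearOrder α] (ρ : G →* (α ≃o α))
    (q : α) (H : Subgroup G) (hH : ∀ g, g ∈ H ↔ ρ g q = q) {R : Set H} (hR : IsDenseCone R)
    (hne : R.Nonempty) : IsDenseCone ({g | q < ρ g q} ∪ H.subtype '' R) := by
  have hinv : ∀ g, q < ρ g⁻¹ q ↔ ρ g q < q := fun g => by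
    rw [← (ρ g).lt_iff_lt, ← RelIso.mul_apply, ← map_mul, mul_inv_cancel, map_one]
    rfl
  refine hR.lex _ H.subtype_injective ?_ ?_ ?_ ?_ ?_ ?_ hne
  · intro a ha b hb
    rw [Set.mem_ofPred_eq, map_mul, RelIso.mul_apply]
    exact lt_trans ha ((ρ a).lt_iff_lt.2 hb)
  · rintro ⟨n, hn⟩ a ha
    rw [Set.mem_ofPred_eq, map_mul, RelIso.mul_apply]
    calc q = ρ n q := ((hH n).1 hn).symm
      _ < _ := (ρ n).lt_iff_lt.2 ha
  · rintro ⟨n, hn⟩ a ha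
    rw [Set.mem_ofPred_eq, map_mul, RelIso.mul_apply]
    simpa [(hH n).1 hn] using ha
  · intro g
    rcases lt_trichotomy q (ρ g q) with h | h | h
    · exact Or.inl h
    · exact Or.inr (Or.inr ⟨⟨g, (hH g).2 h.symm⟩, rfl⟩)
    · exact Or.inr (Or.inl ((hinv g).2 h))
  · intro g hg h
    exact lt_asymm hg ((hinv g).1 h)
  · rintro ⟨n, hn⟩ h
    exact h.ne ((hH n).1 hn).symm

/-- For the free group on `n ≥ 2` generators, `LO(F_n)` is the closure of the set of dense
orderings. -/
theorem free_group_LO_eq_closure_dense {n : ℕ} (hn : 2 ≤ n)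
    (P : Set (FreeGroup (Fin n))) (hP : IsLeftCone P)
    (S : Finset (FreeGroup (Fin n))) (hS : ↑S ⊆ P) :
    ∃ Q : Set (FreeGroup (Fin n)), IsDenseCone Q ∧ ↑S ⊆ Q := by
  have hxy : (⟨0, by lia⟩ : Fin n) ≠ ⟨1, by lia⟩ := by simp
  obtain ⟨ρ, q, hq, u, v, hu, hv, huv⟩ := FreeGroup.exists_action_realizing hxy hP S hS
  let H : Subgroup (FreeGroup (Fin n)) := (MulAction.stabilizer (ℚ ≃o ℚ) q).comap ρ
  have hH : ∀ g, g ∈ H ↔ ρ g q = q := fun g => Iff.rfl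
  obtain ⟨R, hR, hne⟩ := FreeGroup.exists_isDenseCone_subgroup hP H ((hH u).2 hu) ((hH v).2 hv) huv
  exact ⟨_, IsDenseCone.of_stabilizer ρ q H hH hR hne, fun s hs => Or.inl (hq s hs)⟩
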